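/- For all V-functors f : X' → X and g : Y' → Y and every V-module φ : X ⇸ Y, the Hausdorff extension satisfies H̃(g^* · φ · f_*) = (Hg)^* · H̃φ · (Hf)_*, where (g^* · φ · f_*)(x',y') = φ(f(x'), g(y')). (This is the instance for the 2-functor H of the general whiskering identity for lax extensions of 2-functors.) -/

import Mathlib

universe u v

/-- A commutative unital quantale: a complete lattice with a commutative monoid
structure whose multiplication preserves arbitrary suprema in each variable,
and whose unit `k = 1` satisfies `⊥ < 1`. -/
class CommQuantale (V : Type u) extends CompleteLattice V, CommMonoid V where
  mul_sSup : ∀ (a : V) (s : Set V), a * sSup s = ⨆ b ∈ s, a * b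
  bot_lt_one : (⊥ : V) < 1

variable {V : Type u} [CommQuantale V]

/-- The internal hom `x ⊸ y` of the quantale, characterized by `z ≤ x ⊸ y ↔ z * x ≤ y`. -/
def qhom (x y : V) : V := sSup {z : V | z * x ≤ y}

/-- `a : X → X → V` is a `V`-category structure. -/
def IsVCat {X : Type*} (a : X → X → V) : Prop :=
  (∀ x, (1 : V) ≤ a x x) ∧ (∀ x y z, a x y * a y z ≤ a x z)

/-- `f` is a `V`-functor from `(X,a)` to `(Y,b)`. -/
def IsVFun {X Y : Type*} (a : X → X → V) (b : Y → Y → V) (f : X → Y) : Prop :=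
  ∀ x y, a x y ≤ b (f x) (f y)

/-- `φ` is a `V`-module from `(X,a)` to `(Y,b)`. -/
def IsVMod {X Y : Type*} (a : X → X → V) (b : Y → Y → V) (φ : X → Y → V) : Prop :=
  (∀ x' x y, a x' x * φ x y ≤ φ x' y) ∧ (∀ x y y', φ x y * b y y' ≤ φ x y')

/-- The Hausdorff formula: for `φ = a` this is the Hausdorff structure `h_X` on `P X`;
for a `V`-module `φ` it is the lax (Hausdorff) extension `H̃φ`. -/
def hf {X Y : Type*} (φ : X → Y → V) (A : Set X) (B : Set Y) : V :=
  ⨅ x ∈ A, ⨆ y ∈ B, φ x y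

/-- Module composition: `mcomp φ ψ` is `ψ · φ` in the paper's notation. -/
def mcomp {X Y Z : Type*} (φ : X → Y → V) (ψ : Y → Z → V) : X → Z → V :=
  fun x z => ⨆ y, φ x y * ψ y z

/-- The Gromov–Hausdorff "distance": the join of `H̃φ(X,Y)` over all `V`-modules
`φ : X ⇸ Y`. -/
def GH {X Y : Type*} (a : X → X → V) (b : Y → Y → V) : V :=
  ⨆ φ : {φ : X → Y → V // IsVMod a b φ}, hf φ.1 Set.univ Set.univ

theorem q_mul_le_mul_left (c : V) {x y : V} (h : x ≤ y) : c * x ≤ c * y := by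
  have h1 := CommQuantale.mul_sSup c {x, y}
  have h2 : sSup {x, y} = y := by rw [sSup_pair]; exact sup_eq_right.2 h
  rw [h2] at h1
  rw [h1]
  exact le_iSup₂_of_le (f := fun b (_ : b ∈ ({x, y} : Set V)) => c * b) x (by simp) le_rfl

theorem q_mul_le_mul {x y z w : V} (h : x ≤ y) (h' : z ≤ w) : x * z ≤ y * w := by
  refine (q_mul_le_mul_left x h').trans ?_
  rw [mul_comm x, mul_comm y]
  exact q_mul_le_mul_left w h

theorem q_mul_biSup {ι : Type*} (c : V) (s : Set ι) (F : ι → V) (d : V)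
    (h : ∀ i ∈ s, c * F i ≤ d) : c * (⨆ i ∈ s, F i) ≤ d := by
  rw [← sSup_image, CommQuantale.mul_sSup]
  refine iSup₂_le ?_
  rintro _ ⟨i, hi, rfl⟩
  exact h i hi

theorem hf_mul_le {X Y Z : Type*} (φ : X → Y → V) (ψ : Y → Z → V) (χ : X → Z → V)
    (h : ∀ x y z, φ x y * ψ y z ≤ χ x z) (A : Set X) (B : Set Y) (C : Set Z) :
    hf φ A B * hf ψ B C ≤ hf χ A C := by
  refine le_iInf₂ fun x hx => ?_
  refine (q_mul_le_mul (iInf₂_le x hx) le_rfl).trans ?_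
  rw [mul_comm]
  refine q_mul_biSup _ _ _ _ fun y hy => ?_
  rw [mul_comm]
  refine (q_mul_le_mul_left _ (iInf₂_le y hy)).trans ?_
  refine q_mul_biSup _ _ _ _ fun z hz => ?_
  exact (h x y z).trans (le_iSup₂_of_le (f := fun z (_ : z ∈ C) => χ x z) z hz le_rfl)

theorem one_le_hf {X : Type*} (a : X → X → V) (h : ∀ x, 1 ≤ a x x) (A : Set X) :
    1 ≤ hf a A A :=
  le_iInf₂ fun x hx => (h x).trans (le_iSup₂_of_le (f := fun z (_ : z ∈ A) => a x z) x hx le_rfl)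

/-- for V-functors `f : X' → X`, `g : Y' → Y` and a V-module
`φ : X ⇸ Y`, the Hausdorff extension satisfies
`H̃(g^* · φ · f_*) = (Hg)^* · H̃φ · (Hf)_*`, where
`(g^* · φ · f_*)(x',y') = φ(f x', g y')`, `(Hf)_*(A',A) = h_X(f(A'),A)` and
`(Hg)^*(B,B') = h_Y(B, g(B'))`.  (`mcomp ρ σ` denotes the composite `σ · ρ`.) -/
theorem hausdorff_extension_whiskering {X X' Y Y' : Type v}
    (a : X → X → V) (a' : X' → X' → V) (b : Y → Y → V) (b' : Y' → Y' → V)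
    (ha : IsVCat a) (ha' : IsVCat a') (hb : IsVCat b) (hb' : IsVCat b')
    (f : X' → X) (hf' : IsVFun a' a f) (g : Y' → Y) (hg : IsVFun b' b g)
    (φ : X → Y → V) (hφ : IsVMod a b φ) :
    ∀ (A' : Set X') (B' : Set Y'),
      hf (fun x' y' => φ (f x') (g y')) A' B'
        = mcomp (mcomp (fun (A' : Set X') (A : Set X) => hf a (f '' A') A) (hf φ))
            (fun (B : Set Y) (B' : Set Y') => hf b B (g '' B')) A' B' := by
  intro A' B'
  have key : hf (fun x' y' => φ (f x') (g y')) A' B' = hf φ (f '' A') (g '' B') := by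
    simp only [hf, iInf_image, iSup_image]
  rw [key]
  apply le_antisymm
  · refine le_trans ?_ (le_iSup _ (g '' B'))
    have h1 : hf φ (f '' A') (g '' B') ≤
        mcomp (fun (A' : Set X') (A : Set X) => hf a (f '' A') A) (hf φ) A' (g '' B') := by
      refine le_trans ?_ (le_iSup _ (f '' A'))
      have := q_mul_le_mul (one_le_hf a ha.1 (f '' A')) (le_refl (hf φ (f '' A') (g '' B')))
      rwa [one_mul] at this
    have := q_mul_le_mul h1 (one_le_hf b hb.1 (g '' B'))
    rwa [mul_one] at this
  · refine iSup_le fun B => ?_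
    have h1 : mcomp (fun (A' : Set X') (A : Set X) => hf a (f '' A') A) (hf φ) A' B ≤
        hf φ (f '' A') B :=
      iSup_le fun A => hf_mul_le a φ φ hφ.1 _ _ _
    exact (q_mul_le_mul h1 le_rfl).trans (hf_mul_le φ b φ hφ.2 _ _ _)
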